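/- Let G be a connected finite simple (C₄,C₅)-free graph of order n, minimum degree δ ≥ 3 and maximum degree Δ. Then avec(G) ≤ ((n − Δ°)/(2δ°))·((9n + 3Δ°)/n) + 21, where δ° = 2δ² − 5δ + 5 if δ is even, δ° = 2δ² − 5δ + 7 if δ is odd, and Δ° = Δ(δ−1) + (δ−2)·√(Δ(δ−3)) + 3/2. -/

import Mathlib

open SimpleGraph

/-- The eccentricity of a vertex `v`: the maximum distance from `v` to a vertex of `G`. -/
noncomputable def eccent {V : Type*} (G : SimpleGraph V) (v : V) : ℕ :=
  sSup (Set.range (G.dist v))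

/-- The average eccentricity of a finite graph `G`. -/
noncomputable def avec {V : Type*} (G : SimpleGraph V) : ℝ :=
  (∑ᶠ v, (eccent G v : ℝ)) / (Nat.card V)

/-- `G` contains no cycle of length `m` as a (not necessarily induced) subgraph. -/
def CycleFree {V : Type*} (G : SimpleGraph V) (m : ℕ) : Prop :=
  ∀ ⦃v : V⦄ (w : G.Walk v v), w.IsCycle → w.length ≠ m

namespace SimpleGraph

variable {V : Type*} {G : SimpleGraph V}

lemma false_of_cycleFree_four (h4 : CycleFree G 4) {a b c d : V} (hab : G.Adj a b)
    (hbc : G.Adj b c) (hcd : G.Adj c d) (hda : G.Adj d a) (hac : a ≠ c) (hbd : b ≠ d) :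
    False := by
  refine h4 (Walk.cons hab (.cons hbc (.cons hcd (.cons hda .nil)))) ?_ rfl
  have := hab.ne
  have := hbc.ne
  have := hcd.ne
  have := hda.ne
  rw [Walk.cons_isCycle_iff, Walk.isPath_def]
  simp
  grind

lemma false_of_cycleFree_five (h5 : CycleFree G 5) {a b c d e : V} (hab : G.Adj a b)
    (hbc : G.Adj b c) (hcd : G.Adj c d) (hde : G.Adj d e) (hea : G.Adj e a)
    (hac : a ≠ c) (had : a ≠ d) (hbd : b ≠ d) (hbe : b ≠ e) (hce : c ≠ e) : False := by
  refine h5 (Walk.cons hab (.cons hbc (.cons hcd (.cons hde (.cons hea .nil))))) ?_ rfl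
  have := hab.ne
  have := hbc.ne
  have := hcd.ne
  have := hde.ne
  have := hea.ne
  rw [Walk.cons_isCycle_iff, Walk.isPath_def]
  simp
  grind

lemma Connected.dist_le_two (hG : G.Connected) {a b c : V} (hab : G.Adj a b) (hbc : G.Adj b c) :
    G.dist a c ≤ 2 := by
  have := hG.dist_triangle (u := a) (v := b) (w := c)
  rw [dist_eq_one_iff_adj.2 hab, dist_eq_one_iff_adj.2 hbc] at this
  exact this

/-- A tree metric on a finite set: distances on the vertices of a tree satisfy the four-point
condition and every pair of points is joined by a chain of unit steps. -/
structure IsTreeMetric (s : Finset V) (d : V → V → ℕ) : Prop where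
  self : ∀ x, d x x = 0
  symm : ∀ x y, d x y = d y x
  four_point : ∀ x ∈ s, ∀ y ∈ s, ∀ z ∈ s, ∀ w ∈ s,
    d x y + d z w ≤ max (d x z + d y w) (d x w + d y z)
  exists_between : ∀ x ∈ s, ∀ y ∈ s, ∀ i ≤ d x y, ∃ z ∈ s, d x z = i ∧ d z y = d x y - i

/-- Attach a new leaf `c` at the point `p`. -/
noncomputable def attachLeaf (d : V → V → ℕ) (c p : V) (x y : V) : ℕ :=
  open Classical in
  if x = c then if y = c then 0 else d p y + 1 else if y = c then d x p + 1 else d x y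

lemma IsTreeMetric.attachLeaf [DecidableEq V] {s : Finset V} {d : V → V → ℕ}
    (h : IsTreeMetric s d) {c p : V} (hp : p ∈ s) (hc : c ∉ s) :
    IsTreeMetric (insert c s) (attachLeaf d c p) where
  self x := by
    have := h.self x
    unfold SimpleGraph.attachLeaf; grind
  symm x y := by
    have := h.symm
    unfold SimpleGraph.attachLeaf; grind
  four_point := by
    have hs := h.symm
    have h0 := h.self
    have key : ∀ x ∈ insert c s, ∃ x' ∈ s, (x = c ∧ x' = p) ∨ (x ≠ c ∧ x' = x) := by
      grind
    intro x hx y hy z hz w hw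
    obtain ⟨x', hx', hx⟩ := key x hx
    obtain ⟨y', hy', hy⟩ := key y hy
    obtain ⟨z', hz', hz⟩ := key z hz
    obtain ⟨w', hw', hw⟩ := key w hw
    have h4 := h.four_point x' hx' y' hy' z' hz' w' hw'
    have hpp := h0 p
    have tri : ∀ a ∈ s, ∀ b ∈ s, d a b ≤ d a p + d p b := by
      intro a ha b hb
      have := h.four_point a ha b hb p hp p hp
      have := hs b p
      have := hs a p
      omega
    have t1 := tri x' hx' y' hy'
    have t2 := tri z' hz' w' hw'
    have e1 := hs x' p
    have e2 := hs y' p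
    have e3 := hs z' p
    have e4 := hs w' p
    unfold SimpleGraph.attachLeaf
    rcases hx with ⟨rfl, rfl⟩ | ⟨hx, rfl⟩ <;> rcases hy with ⟨rfl, rfl⟩ | ⟨hy, rfl⟩ <;>
      rcases hz with ⟨rfl, rfl⟩ | ⟨hz, rfl⟩ <;> rcases hw with ⟨rfl, rfl⟩ | ⟨hw, rfl⟩ <;>
      split_ifs <;> first | contradiction | omega
  exists_between := by
    intro x hx y hy i hi
    have hs := h.symm
    have h0 := h.self
    have hb := h.exists_between
    unfold SimpleGraph.attachLeaf at hi ⊢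
    rcases Finset.mem_insert.1 hx with hxc | hxs <;> rcases Finset.mem_insert.1 hy with hyc | hys
    · exact ⟨c, by simp, by grind⟩
    · have hyx : y ≠ c := by grind
      rcases i with _ | i
      · exact ⟨c, by simp, by grind⟩
      · obtain ⟨z, hz, h1, h2⟩ := hb p hp y hys i (by grind)
        exact ⟨z, by grind, by grind⟩
    · have hyx : x ≠ c := by grind
      by_cases hi' : i = d x p + 1
      · exact ⟨c, by simp, by grind⟩
      · obtain ⟨z, hz, h1, h2⟩ := hb x hxs p hp i (by grind)
        exact ⟨z, by grind, by grind⟩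
    · obtain ⟨z, hz, h1, h2⟩ := hb x hxs y hys i (by grind)
      exact ⟨z, by grind, by grind⟩

lemma sq_le_four_mul_sum_min (D : ℕ) :
    D ^ 2 ≤ 4 * ∑ i ∈ Finset.range (D + 1), min i (D - i) + 1 := by
  induction D using Nat.twoStepInduction with
  | zero => simp
  | one => simp [Finset.sum_range_succ]
  | more D ih _ =>
    rw [Finset.sum_range_succ, Finset.sum_range_succ']
    have : ∑ i ∈ Finset.range (D + 1), min (i + 1) (D + 2 - (i + 1)) =
        ∑ i ∈ Finset.range (D + 1), (min i (D - i) + 1) :=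
      Finset.sum_congr rfl fun i hi => by
        have := Finset.mem_range.1 hi
        omega
    rw [this, Finset.sum_add_distrib]
    simp
    nlinarith

end SimpleGraph

namespace SimpleGraph

open Classical Finset

variable {V : Type*} [Fintype V] {G : SimpleGraph V}

/-- The vertices at distance at most `r` from `v`. -/
noncomputable def distBall (G : SimpleGraph V) (r : ℕ) (v : V) : Finset V :=
  {x | G.dist v x ≤ r}

@[simp] lemma mem_distBall {r : ℕ} {v x : V} : x ∈ G.distBall r v ↔ G.dist v x ≤ r := by
  simp [distBall]

/-- The neighbours of `a` that are neither `u` nor neighbours of `u`. -/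
noncomputable def outerNeighbors (G : SimpleGraph V) (u a : V) : Finset V :=
  {x | G.Adj a x ∧ x ≠ u ∧ ¬ G.Adj u x}

/-- A set `A` (of neighbours of `u`) together with the outer neighbours of its elements. -/
noncomputable def wing (G : SimpleGraph V) (u : V) (A : Finset V) : Finset V :=
  A ∪ A.biUnion (G.outerNeighbors u)

lemma mem_wing {u x : V} {A : Finset V} :
    x ∈ G.wing u A ↔ x ∈ A ∨ ∃ a ∈ A, G.Adj a x ∧ x ≠ u ∧ ¬ G.Adj u x := by
  simp [wing, outerNeighbors]

lemma degree_le_card_outerNeighbors_add_one {u a : V}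
    (h : ∀ x, G.Adj a x → ¬ G.Adj u x) : G.degree a ≤ #(G.outerNeighbors u a) + 1 := by
  rw [← card_neighborFinset_eq_degree]
  calc #(G.neighborFinset a) ≤ #(insert u (G.outerNeighbors u a)) := card_le_card fun x hx => by
        have := h x
        simp [outerNeighbors] at hx ⊢
        tauto
    _ ≤ _ := card_insert_le _ _

lemma degree_le_card_outerNeighbors_add_two (h4 : CycleFree G 4) {u a : V} (hua : G.Adj u a) :
    G.degree a ≤ #(G.outerNeighbors u a) + 2 := by
  by_cases h : ∃ b, G.Adj a b ∧ G.Adj u b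
  · obtain ⟨b, hab, hub⟩ := h
    rw [← card_neighborFinset_eq_degree]
    calc #(G.neighborFinset a) ≤ #(insert u (insert b (G.outerNeighbors u a))) :=
          card_le_card fun x hx => by
            simp [outerNeighbors] at hx ⊢
            by_contra! hc
            exact false_of_cycleFree_four h4 hx (hc.2.2 hx hc.1).symm hub hab.symm hua.ne' hc.2.1
      _ ≤ _ := (card_insert_le _ _).trans (Nat.succ_le_succ (card_insert_le _ _))
  · push Not at h
    exact (degree_le_card_outerNeighbors_add_one h).trans (by omega)

lemma card_wing (h4 : CycleFree G 4) {u : V} {A : Finset V} (hA : ∀ a ∈ A, G.Adj u a) :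
    #(G.wing u A) = #A + ∑ a ∈ A, #(G.outerNeighbors u a) := by
  rw [wing, card_union_of_disjoint, card_biUnion]
  · intro a ha b hb hab
    rw [Function.onFun_apply, Finset.disjoint_left]
    intro x hx hx'
    simp [outerNeighbors] at hx hx'
    exact false_of_cycleFree_four h4 hx.1 hx'.1.symm (hA b hb).symm (hA a ha) hab hx.2.1
  · rw [Finset.disjoint_left]
    intro x hx hx'
    simp [outerNeighbors] at hx'
    obtain ⟨a, ha, h⟩ := hx'
    exact h.2.2 (hA x hx)

lemma card_mul_le_card_wing (h4 : CycleFree G 4) {k : ℕ} (hk : ∀ v, k + 2 ≤ G.degree v) {u : V}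
    {A : Finset V} (hA : ∀ a ∈ A, G.Adj u a) : #A * (k + 1) ≤ #(G.wing u A) := by
  rw [card_wing h4 hA]
  have : #A * k ≤ ∑ a ∈ A, #(G.outerNeighbors u a) := by
    rw [← smul_eq_mul]
    refine card_nsmul_le_sum _ _ _ fun a ha => ?_
    have := degree_le_card_outerNeighbors_add_two h4 (hA a ha)
    have := hk a
    omega
  linarith

lemma exists_forall_not_adj_of_odd (h4 : CycleFree G 4) {u : V}
    {A : Finset V} (hA : ∀ a ∈ A, G.Adj u a) (hodd : Odd #A) :
    ∃ a ∈ A, ∀ b ∈ A, ¬ G.Adj a b := by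
  by_contra! hc
  choose! m hmA hm using hc
  have huniq : ∀ a ∈ A, m (m a) = a := fun a ha => by
    by_contra hne
    exact false_of_cycleFree_four h4 (hA a ha) (hm a ha) (hm _ (hmA a ha))
      (hA _ (hmA _ (hmA a ha))).symm (hA _ (hmA a ha)).ne (Ne.symm hne)
  have := Finset.sum_involution (s := A) (f := fun _ => (1 : ZMod 2)) (fun a _ => m a)
    (fun _ _ => by decide) (fun a ha _ => (hm a ha).ne') (fun a ha => hmA a ha)
    (fun a ha => huniq a ha)
  rw [sum_const, nsmul_one, ZMod.natCast_eq_zero_iff_even] at this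
  exact Nat.not_even_iff_odd.2 hodd this

lemma card_mul_lt_card_wing_of_odd (h4 : CycleFree G 4) {k : ℕ} (hk : ∀ v, k + 2 ≤ G.degree v)
    {u : V} {A : Finset V} (hA : ∀ a ∈ A, G.Adj u a)
    (hcl : ∀ a ∈ A, ∀ b, G.Adj a b → G.Adj u b → b ∈ A) (hodd : Odd #A) :
    #A * (k + 1) < #(G.wing u A) := by
  rw [card_wing h4 hA]
  obtain ⟨a₀, ha₀, h₀⟩ := exists_forall_not_adj_of_odd h4 hA hodd
  have : #A * k < ∑ a ∈ A, #(G.outerNeighbors u a) := by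
    rw [← smul_eq_mul, ← sum_const]
    refine sum_lt_sum (fun a ha => ?_) ⟨a₀, ha₀, ?_⟩
    · have := degree_le_card_outerNeighbors_add_two h4 (hA a ha)
      have := hk a
      omega
    · have := degree_le_card_outerNeighbors_add_one (G := G) (u := u) (a := a₀)
        fun x hx hux => h₀ x (hcl a₀ ha₀ x hx hux) hx
      have := hk a₀
      omega
  linarith

/-- The neighbours of `u` other than `v` and the common neighbours of `u` and `v`. -/
noncomputable def privateNeighbors (G : SimpleGraph V) (u v : V) : Finset V :=
  {x | G.Adj u x ∧ x ≠ v ∧ ¬ G.Adj v x}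

lemma wing_privateNeighbors_subset (hG : G.Connected) (u v : V) :
    G.wing u (G.privateNeighbors u v) ⊆ G.distBall 2 u := by
  intro x hx
  simp only [mem_wing, privateNeighbors, mem_filter, mem_univ, true_and, mem_distBall] at hx ⊢
  rcases hx with hx | ⟨a, ha, hax, -⟩
  · exact (dist_eq_one_iff_adj.2 hx.1).le.trans (by norm_num)
  · exact hG.dist_le_two ha.1 hax

lemma disjoint_wing_privateNeighbors (h4 : CycleFree G 4) (h5 : CycleFree G 5) {u v : V}
    (huv : G.Adj u v) :
    Disjoint (G.wing u (G.privateNeighbors u v)) (G.wing v (G.privateNeighbors v u)) := by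
  rw [Finset.disjoint_left]
  intro x hx hx'
  simp only [mem_wing, privateNeighbors, mem_filter, mem_univ, true_and] at hx hx'
  rcases hx with hx | ⟨a, ha, hax, hxu, hux⟩ <;> rcases hx' with hx' | ⟨b, hb, hbx, hxv, hvx⟩
  · exact hx.2.2 hx'.1
  · exact false_of_cycleFree_four h4 huv hb.1 hbx hx.1.symm hb.2.1.symm hxv.symm
  · exact false_of_cycleFree_four h4 huv.symm ha.1 hax hx'.1.symm ha.2.1.symm hxu.symm
  · refine false_of_cycleFree_five h5 huv hb.1 hbx hax.symm ha.1.symm hb.2.1.symm hxu.symm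
      hxv.symm ha.2.1.symm ?_
    rintro rfl
    exact ha.2.2 hb.1

lemma notMem_wing_privateNeighbors {u v : V} (huv : G.Adj u v) :
    u ∉ G.wing u (G.privateNeighbors u v) ∧ v ∉ G.wing u (G.privateNeighbors u v) := by
  simp [mem_wing, privateNeighbors, huv]

/-- The parity-dependent bound on the number of vertices near an edge, for minimum degree
`k + 2`. -/
lemma card_distBall_union_distBall (hG : G.Connected) (h4 : CycleFree G 4) (h5 : CycleFree G 5)
    {k : ℕ} (hk1 : 1 ≤ k) (hk : ∀ v, k + 2 ≤ G.degree v) {u v : V} (huv : G.Adj u v) :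
    2 * k ^ 2 + 3 * k + 3 + (if Even k then 0 else 2) ≤ #(G.distBall 2 u ∪ G.distBall 2 v) := by
  have hA : ∀ x y, ∀ a ∈ G.privateNeighbors x y, G.Adj x a := fun x y a ha => by
    simp [privateNeighbors] at ha; exact ha.1
  have hU := card_mul_le_card_wing h4 hk (hA u v)
  have hW := card_mul_le_card_wing h4 hk (hA v u)
  have hdis := disjoint_wing_privateNeighbors h4 h5 huv
  by_cases hw : ∃ w, G.Adj u w ∧ G.Adj v w
  · obtain ⟨w, huw, hvw⟩ := hw
    have hcard : ∀ x y, G.Adj x y → G.Adj x w → G.Adj y w → k ≤ #(G.privateNeighbors x y) := by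
      intro x y hxy hxw hyw
      have : #(G.neighborFinset x) ≤ #(insert y (insert w (G.privateNeighbors x y))) :=
        card_le_card fun z hz => by
          simp [privateNeighbors] at hz ⊢
          by_contra! hc
          exact false_of_cycleFree_four h4 hz (hc.2.2 hz hc.1).symm hyw hxw.symm hxy.ne hc.2.1
      have h1 := card_insert_le y (insert w (G.privateNeighbors x y))
      have h2 := card_insert_le w (G.privateNeighbors x y)
      have := hk x
      rw [card_neighborFinset_eq_degree] at *
      omega
    have hwing : ∀ x y, G.Adj x y → G.Adj x w → G.Adj y w →
        k * (k + 1) + (if Even k then 0 else 1) ≤ #(G.wing x (G.privateNeighbors x y)) := by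
      intro x y hxy hxw hyw
      have h1 := hcard x y hxy hxw hyw
      have h2 := card_mul_le_card_wing h4 hk (hA x y)
      split_ifs with hev
      · nlinarith
      · rcases h1.eq_or_lt with h1 | h1
        · have := card_mul_lt_card_wing_of_odd h4 hk (hA x y) (fun a ha b hab hxb => by
            simp [privateNeighbors] at ha ⊢
            refine ⟨hxb, ?_, fun hyb => ?_⟩
            · rintro rfl
              exact ha.2.2 hab.symm
            · exact false_of_cycleFree_four h4 ha.1 hab hyb.symm hxy.symm hxb.ne ha.2.1)
            (by rw [← h1]; exact Nat.not_even_iff_odd.1 hev)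
          rw [← h1] at this
          omega
        · nlinarith
    have hU := hwing u v huv huw hvw
    have hW := hwing v u huv.symm hvw huw
    have hO : k ≤ #(G.outerNeighbors u w) := by
      have := degree_le_card_outerNeighbors_add_two h4 huw
      have := hk w
      omega
    have hOdis : Disjoint (G.outerNeighbors u w) (G.wing u (G.privateNeighbors u v) ∪
        G.wing v (G.privateNeighbors v u)) := by
      rw [Finset.disjoint_left]
      intro x hx hx'
      simp only [outerNeighbors, mem_filter, mem_univ, true_and] at hx
      simp only [mem_union, mem_wing, privateNeighbors, mem_filter, mem_univ, true_and] at hx'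
      rcases hx' with (hx' | ⟨a, ha, hax, -⟩) | (hx' | ⟨a, ha, hax, hxv, -⟩)
      · exact hx.2.2 hx'.1
      · refine false_of_cycleFree_four h4 hax hx.1.symm huw.symm ha.1 ?_ hx.2.1
        rintro rfl
        exact ha.2.2 hvw
      · exact false_of_cycleFree_four h4 huv hx'.1 hx.1.symm huw.symm hx'.2.1.symm hvw.ne
      · refine false_of_cycleFree_four h4 hax hx.1.symm hvw.symm ha.1 ?_ hxv
        rintro rfl
        exact ha.2.2 huw
    have hwing_not : ∀ x y, G.Adj x w → G.Adj y w → w ∉ G.wing x (G.privateNeighbors x y) := by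
      intro x y hxw hyw
      simp [mem_wing, privateNeighbors, hxw, hyw]
    have hsub : {u, v, w} ∪ (G.outerNeighbors u w ∪ (G.wing u (G.privateNeighbors u v) ∪
        G.wing v (G.privateNeighbors v u))) ⊆ G.distBall 2 u ∪ G.distBall 2 v := by
      refine union_subset ?_ (union_subset ?_ (union_subset_union
        (wing_privateNeighbors_subset hG u v) (wing_privateNeighbors_subset hG v u)))
      · intro x hx
        simp only [mem_insert, mem_singleton] at hx
        rcases hx with rfl | rfl | rfl
        · simp
        · simp
        · simp [dist_eq_one_iff_adj.2 huw]
      · intro x hx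
        simp only [outerNeighbors, mem_filter, mem_univ, true_and] at hx
        simp [hG.dist_le_two huw hx.1]
    refine le_trans ?_ (card_le_card hsub)
    rw [card_union_of_disjoint, card_union_of_disjoint hOdis, card_union_of_disjoint hdis,
      card_eq_three.2 ⟨u, v, w, huv.ne, huw.ne, hvw.ne, rfl⟩]
    · split_ifs at * <;> nlinarith
    · have ha := notMem_wing_privateNeighbors huv
      have hb := notMem_wing_privateNeighbors huv.symm
      simp [ha, hb, hwing_not u v huw hvw, hwing_not v u hvw huw, outerNeighbors, huv]
  · push Not at hw
    have hcard : ∀ x y, G.Adj x y → (∀ z, G.Adj x z → ¬ G.Adj y z) →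
        k + 1 ≤ #(G.privateNeighbors x y) := by
      intro x y hxy hz
      have : #(G.neighborFinset x) ≤ #(insert y (G.privateNeighbors x y)) :=
        card_le_card fun z hz' => by
          have := hz z
          simp [privateNeighbors] at hz' ⊢
          tauto
      have h2 := card_insert_le y (G.privateNeighbors x y)
      have := hk x
      rw [card_neighborFinset_eq_degree] at *
      omega
    have h1 := hcard u v huv hw
    have h2 := hcard v u huv.symm fun z hz hz' => hw z hz' hz
    have hsub : ({u, v} ∪ (G.wing u (G.privateNeighbors u v) ∪
        G.wing v (G.privateNeighbors v u))) ⊆ G.distBall 2 u ∪ G.distBall 2 v := by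
      refine union_subset ?_ (union_subset_union (wing_privateNeighbors_subset hG u v)
        (wing_privateNeighbors_subset hG v u))
      intro x hx
      simp only [mem_insert, mem_singleton] at hx
      rcases hx with rfl | rfl <;> simp
    refine le_trans ?_ (card_le_card hsub)
    rw [card_union_of_disjoint, card_union_of_disjoint hdis, card_pair huv.ne]
    · split_ifs <;> nlinarith
    · have ha := notMem_wing_privateNeighbors huv
      have hb := notMem_wing_privateNeighbors huv.symm
      simp [ha, hb]

/-- The vertices reached from `v` by a path of length two that are neither `v` nor its
neighbours. -/
noncomputable def secondNeighbors (G : SimpleGraph V) (v : V) : Finset V :=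
  (G.neighborFinset v).biUnion (G.outerNeighbors v)

/-- The neighbours of `x` outside the ball of radius two around `v`. -/
noncomputable def farNeighbors (G : SimpleGraph V) (v x : V) : Finset V :=
  G.neighborFinset x \ (insert v (G.neighborFinset v ∪ G.secondNeighbors v))

lemma mem_secondNeighbors {v x : V} :
    x ∈ G.secondNeighbors v ↔ ∃ a, G.Adj v a ∧ G.Adj a x ∧ x ≠ v ∧ ¬ G.Adj v x := by
  simp [secondNeighbors, outerNeighbors]

lemma adj_parent_of_adj_secondNeighbors (h5 : CycleFree G 5) {v a x y : V}
    (hva : G.Adj v a) (hax : G.Adj a x) (hxv : x ≠ v)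
    (hvx : ¬ G.Adj v x) (hxy : G.Adj x y) (hy : y ∈ G.secondNeighbors v) : G.Adj a y := by
  obtain ⟨b, hvb, hby, hyv, hvy⟩ := mem_secondNeighbors.1 hy
  by_contra hay
  have hab : a ≠ b := by
    rintro rfl
    exact hay hby
  exact false_of_cycleFree_five h5 hva hax hxy hby.symm hvb.symm hxv.symm hyv.symm
    (by rintro rfl; exact hvy hva) hab (by rintro rfl; exact hvx hvb)

lemma le_card_farNeighbors (h4 : CycleFree G 4) (h5 : CycleFree G 5) {k : ℕ}
    (hk : ∀ v, k + 2 ≤ G.degree v) {v x : V} (hx : x ∈ G.secondNeighbors v) :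
    k ≤ #(G.farNeighbors v x) := by
  obtain ⟨a, hva, hax, hxv, hvx⟩ := mem_secondNeighbors.1 hx
  have h1 : #(G.neighborFinset x ∩ G.neighborFinset v) ≤ 1 := by
    refine card_le_one.2 fun b hb c hc => ?_
    simp only [mem_inter, mem_neighborFinset] at hb hc
    by_contra hbc
    exact false_of_cycleFree_four h4 hb.1 hb.2.symm hc.2 hc.1.symm hxv hbc
  have h2 : #(G.neighborFinset x ∩ G.secondNeighbors v) ≤ 1 := by
    refine card_le_one.2 fun b hb c hc => ?_
    simp only [mem_inter, mem_neighborFinset] at hb hc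
    by_contra hbc
    exact false_of_cycleFree_four h4 hb.1
      (adj_parent_of_adj_secondNeighbors h5 hva hax hxv hvx hb.1 hb.2).symm
      (adj_parent_of_adj_secondNeighbors h5 hva hax hxv hvx hc.1 hc.2) hc.1.symm hax.ne' hbc
  have hsub : G.neighborFinset x ⊆ G.farNeighbors v x ∪
      (G.neighborFinset x ∩ G.neighborFinset v ∪ G.neighborFinset x ∩ G.secondNeighbors v) := by
    intro z hz
    have : z ≠ v := by
      rintro rfl
      exact hvx ((G.mem_neighborFinset _ _).1 hz).symm
    simp only [farNeighbors, mem_union, mem_sdiff, mem_inter, mem_insert]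
    tauto
  have h3 := card_le_card hsub
  have h4 := card_union_le (G.farNeighbors v x)
    (G.neighborFinset x ∩ G.neighborFinset v ∪ G.neighborFinset x ∩ G.secondNeighbors v)
  have h5 := card_union_le (G.neighborFinset x ∩ G.neighborFinset v)
    (G.neighborFinset x ∩ G.secondNeighbors v)
  have h6 := hk x
  rw [card_neighborFinset_eq_degree] at h3
  omega

lemma card_secondNeighbors (h4 : CycleFree G 4) {k : ℕ} (hk : ∀ v, k + 2 ≤ G.degree v) (v : V) :
    G.degree v * k ≤ #(G.secondNeighbors v) := by
  have h := card_mul_le_card_wing h4 hk (u := v) (A := G.neighborFinset v) (by simp)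
  have h' := card_union_le (G.neighborFinset v) (G.secondNeighbors v)
  have : G.wing v (G.neighborFinset v) = G.neighborFinset v ∪ G.secondNeighbors v := rfl
  rw [this] at h
  rw [card_neighborFinset_eq_degree] at h h'
  linarith

/-- A lower bound for the third distance layer, by counting pairs of vertices with a common
neighbour in the second layer. -/
lemma card_mul_le_card_biUnion_farNeighbors (h4 : CycleFree G 4) (h5 : CycleFree G 5) {k : ℕ}
    (hk : ∀ v, k + 2 ≤ G.degree v) (v : V) :
    G.degree v * k * (k * k - k) ≤
      #((G.secondNeighbors v).biUnion (G.farNeighbors v)) *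
        #((G.secondNeighbors v).biUnion (G.farNeighbors v)) -
          #((G.secondNeighbors v).biUnion (G.farNeighbors v)) := by
  rw [← offDiag_card]
  have hsub : (G.secondNeighbors v).biUnion (fun x => (G.farNeighbors v x).offDiag) ⊆
      ((G.secondNeighbors v).biUnion (G.farNeighbors v)).offDiag := by
    intro p hp
    simp only [mem_biUnion, mem_offDiag] at hp ⊢
    obtain ⟨x, hx, h1, h2, h3⟩ := hp
    exact ⟨⟨x, hx, h1⟩, ⟨x, hx, h2⟩, h3⟩
  refine le_trans ?_ (card_le_card hsub)
  rw [card_biUnion]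
  · calc G.degree v * k * (k * k - k) ≤ #(G.secondNeighbors v) * (k * k - k) := by
          gcongr
          exact card_secondNeighbors h4 hk v
      _ ≤ _ := by
          rw [← smul_eq_mul]
          refine card_nsmul_le_sum _ _ _ fun x hx => ?_
          have := le_card_farNeighbors h4 h5 hk hx
          rw [offDiag_card, ← Nat.mul_sub_one, ← Nat.mul_sub_one]
          gcongr
  · intro x hx y hy hxy
    rw [Function.onFun_apply, Finset.disjoint_left]
    intro p hp hp'
    simp only [mem_offDiag, farNeighbors, mem_sdiff, mem_neighborFinset] at hp hp'
    exact false_of_cycleFree_four h4 hp.1.1 hp'.1.1.symm hp'.2.1.1 hp.2.1.1.symm hxy hp.2.2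

lemma card_distBall_three (hG : G.Connected) (h4 : CycleFree G 4) (h5 : CycleFree G 5) {k : ℕ}
    (hk1 : 1 ≤ k) (hk : ∀ v, k + 2 ≤ G.degree v) (v : V) :
    (G.degree v : ℝ) * (k + 1) + k * √(G.degree v * (k - 1)) + 3 / 2 ≤ #(G.distBall 3 v) := by
  set N := (G.secondNeighbors v).biUnion (G.farNeighbors v) with hN
  have hpairs : G.degree v * k * (k * k - k) ≤ #N * #N - #N :=
    card_mul_le_card_biUnion_farNeighbors h4 h5 hk v
  have hwing := card_mul_le_card_wing h4 hk (u := v) (A := G.neighborFinset v) (by simp)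
  rw [card_neighborFinset_eq_degree] at hwing
  have hwing_eq : G.wing v (G.neighborFinset v) = G.neighborFinset v ∪ G.secondNeighbors v := rfl
  have hNpos : 1 ≤ #N := by
    have h1 := card_secondNeighbors h4 hk v
    have h2 : 0 < #(G.secondNeighbors v) := by
      have := hk v
      exact lt_of_lt_of_le (Nat.mul_pos (by omega) hk1) h1
    obtain ⟨x, hx⟩ := card_pos.1 h2
    exact hk1.trans ((le_card_farNeighbors h4 h5 hk hx).trans
      (card_le_card (subset_biUnion_of_mem (G.farNeighbors v) hx)))
  have hsub : insert v (G.wing v (G.neighborFinset v)) ∪ N ⊆ G.distBall 3 v := by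
    have hsecond : ∀ x ∈ G.secondNeighbors v, G.dist v x ≤ 2 := fun x hx => by
      obtain ⟨a, hva, hax, -⟩ := mem_secondNeighbors.1 hx
      exact hG.dist_le_two hva hax
    intro x hx
    rw [mem_distBall]
    simp only [hwing_eq, hN, mem_union, mem_insert, mem_biUnion, mem_neighborFinset] at hx
    rcases hx with (rfl | hx | hx) | ⟨y, hy, hx⟩
    · simp
    · rw [dist_eq_one_iff_adj.2 hx]
      norm_num
    · exact (hsecond x hx).trans (by norm_num)
    · simp only [farNeighbors, mem_sdiff, mem_neighborFinset] at hx
      have h1 := hsecond y hy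
      have h2 := hG.dist_triangle (u := v) (v := y) (w := x)
      rw [dist_eq_one_iff_adj.2 hx.1] at h2
      omega
  have hcard := card_le_card hsub
  rw [card_union_of_disjoint, card_insert_of_notMem] at hcard
  rotate_left
  · simp [mem_wing]
  · rw [Finset.disjoint_right]
    intro x hx
    obtain ⟨y, -, hx⟩ := mem_biUnion.1 hx
    exact (mem_sdiff.1 hx).2
  have hpairs' : (k * √(G.degree v * (k - 1) : ℝ)) ^ 2 ≤ (#N : ℝ) * #N - #N := by
    have hk0 : (0 : ℝ) ≤ k - 1 := by
      rw [sub_nonneg]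
      exact_mod_cast hk1
    rw [mul_pow, Real.sq_sqrt (by positivity)]
    have h := (Nat.cast_le (α := ℝ)).2 hpairs
    rw [Nat.cast_sub (Nat.le_mul_self _)] at h
    push_cast [Nat.cast_sub (Nat.le_mul_self k)] at h
    linarith
  have hNR : (1 : ℝ) ≤ #N := by exact_mod_cast hNpos
  have hN' : k * √(G.degree v * (k - 1) : ℝ) ≤ (#N : ℝ) - 1 / 2 :=
    le_of_sq_le_sq (by nlinarith) (by linarith)
  have hwing' : (G.degree v : ℝ) * (k + 1) ≤ #(G.wing v (G.neighborFinset v)) := by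
    exact_mod_cast hwing
  have hcard' : (#(G.wing v (G.neighborFinset v)) : ℝ) + 1 + #N ≤ #(G.distBall 3 v) := by
    exact_mod_cast hcard
  linarith

/-- A packing of `G` by disjoint sets `B a` of size at least `q`, one around each centre `a ∈ s`,
whose centres carry a tree metric `d` such that unit steps have length at most six in `G`. -/
structure IsTreePacking (G : SimpleGraph V) (q : ℕ) (r : V) (s : Finset V) (d : V → V → ℕ)
    (B : V → Finset V) : Prop where
  isTreeMetric : IsTreeMetric s d
  root_mem : r ∈ s
  dist_le : ∀ x ∈ s, ∀ y ∈ s, G.dist x y ≤ 6 * d x y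
  center_mem : ∀ a ∈ s, a ∈ B a
  subset_distBall : ∀ a ∈ s, B a ⊆ G.distBall 3 a
  disjoint : ∀ a ∈ s, ∀ b ∈ s, a ≠ b → Disjoint (B a) (B b)
  le_card : ∀ a ∈ s, q ≤ #(B a)
  root_eq : B r = G.distBall 3 r

lemma isTreePacking_singleton {q : ℕ} {r : V} (hq : q ≤ #(G.distBall 3 r)) :
    IsTreePacking G q r {r} (fun _ _ => 0) (G.distBall 3) := by
  refine ⟨⟨?_, ?_, ?_, ?_⟩, ?_, ?_, ?_, ?_, ?_, ?_, ?_⟩ <;> simp_all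

lemma IsTreePacking.extend (hG : G.Connected) {q : ℕ} {r : V} {s : Finset V} {d : V → V → ℕ}
    {B : V → Finset V} (h : IsTreePacking G q r s d B)
    (hq : ∀ u v, G.Adj u v → q ≤ #(G.distBall 2 u ∪ G.distBall 2 v)) {z w p : V} (hp : p ∈ s)
    (hzw : G.Adj z w) (hzp : G.dist z p ≤ 6)
    (hz : ∀ a ∈ s, Disjoint (G.distBall 2 z) (B a))
    (hw : ∀ a ∈ s, Disjoint (G.distBall 2 w) (B a)) :
    z ∉ s ∧ IsTreePacking G q r (insert z s) (attachLeaf d z p)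
      (Function.update B z (G.distBall 2 z ∪ G.distBall 2 w)) := by
  have hzs : z ∉ s := fun hzs =>
    Finset.disjoint_left.1 (hz z hzs) (by simp) (h.center_mem z hzs)
  have hne : ∀ a ∈ s, a ≠ z := by
    rintro a ha rfl
    exact hzs ha
  have hdis : ∀ a ∈ s, Disjoint (G.distBall 2 z ∪ G.distBall 2 w) (B a) := fun a ha =>
    disjoint_union_left.2 ⟨hz a ha, hw a ha⟩
  have hdist : ∀ a ∈ s, G.dist z a ≤ 6 * (d p a + 1) := fun a ha => by
    have h1 := h.dist_le p hp a ha
    have h2 := hG.dist_triangle (u := z) (v := p) (w := a)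
    omega
  refine ⟨hzs, ⟨h.isTreeMetric.attachLeaf hp hzs, mem_insert_of_mem h.root_mem, ?_, ?_, ?_, ?_,
    ?_, ?_⟩⟩
  · intro x hx y hy
    unfold SimpleGraph.attachLeaf
    rcases mem_insert.1 hx with rfl | hxs <;> rcases mem_insert.1 hy with rfl | hys
    · simp
    · simpa [hne y hys] using hdist y hys
    · rw [dist_comm]
      simpa [hne x hxs, h.isTreeMetric.symm x p] using hdist x hxs
    · simpa [hne x hxs, hne y hys] using h.dist_le x hxs y hys
  · intro a ha
    rcases mem_insert.1 ha with rfl | ha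
    · simp
    · simpa [hne a ha] using h.center_mem a ha
  · intro a ha
    rcases mem_insert.1 ha with rfl | ha
    · rw [Function.update_self]
      refine union_subset ?_ ?_ <;> intro x hx <;> rw [mem_distBall] at *
      · omega
      · have h2 := hG.dist_triangle (u := a) (v := w) (w := x)
        rw [dist_eq_one_iff_adj.2 hzw] at h2
        omega
    · simpa [hne a ha] using h.subset_distBall a ha
  · intro a ha b hb hab
    rcases mem_insert.1 ha with rfl | has <;> rcases mem_insert.1 hb with rfl | hbs
    · exact absurd rfl hab
    · simpa [hne b hbs] using hdis b hbs
    · simpa [hne a has] using (hdis a has).symm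
    · simpa [hne a has, hne b hbs] using h.disjoint a has b hbs hab
  · intro a ha
    rcases mem_insert.1 ha with rfl | ha
    · rw [Function.update_self]
      exact hq _ _ hzw
    · simpa [hne a ha] using h.le_card a ha
  · simpa [hne r h.root_mem] using h.root_eq

lemma exists_isTreePacking_covering (hG : G.Connected) {q : ℕ} (r : V)
    (hdeg : ∀ v, ∃ w, G.Adj v w)
    (hq : ∀ u v, G.Adj u v → q ≤ #(G.distBall 2 u ∪ G.distBall 2 v)) :
    ∃ s d B, IsTreePacking G q r s d B ∧ ∀ u, ∃ a ∈ s, G.dist u a ≤ 6 := by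
  have hr : q ≤ #(G.distBall 3 r) := by
    obtain ⟨w, hw⟩ := hdeg r
    refine (hq r w hw).trans (card_le_card (union_subset ?_ ?_)) <;> intro x hx <;>
      rw [mem_distBall] at *
    · omega
    · have h2 := hG.dist_triangle (u := r) (v := w) (w := x)
      rw [dist_eq_one_iff_adj.2 hw] at h2
      omega
  obtain ⟨s, hs, hmax⟩ := Finset.exists_max_image
    {s : Finset V | ∃ d B, IsTreePacking G q r s d B} card
    ⟨{r}, by simpa using ⟨_, _, isTreePacking_singleton hr⟩⟩
  simp only [mem_filter, mem_univ, true_and] at hs hmax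
  obtain ⟨d, B, h⟩ := hs
  refine ⟨s, d, B, h, ?_⟩
  let near : V → Prop := fun u => ∃ a ∈ s, ¬ Disjoint (G.distBall 2 u) (B a)
  have hnear : ∀ u, near u → ∃ a ∈ s, G.dist u a ≤ 5 := by
    rintro u ⟨a, ha, hua⟩
    obtain ⟨t, htu, hta⟩ := not_disjoint_iff.1 hua
    have h1 := mem_distBall.1 (h.subset_distBall a ha hta)
    have h2 := mem_distBall.1 htu
    have h3 := hG.dist_triangle (u := u) (v := t) (w := a)
    rw [dist_comm (u := t)] at h3
    exact ⟨a, ha, by omega⟩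
  have hstep : ∀ u v, G.Adj u v → ∀ a ∈ s, G.dist v a ≤ 5 → G.dist u a ≤ 6 := by
    intro u v huv a ha hva
    have h3 := hG.dist_triangle (u := u) (v := v) (w := a)
    rw [dist_eq_one_iff_adj.2 huv] at h3
    omega
  have hcov : ∀ u, near u ∨ ∀ w, G.Adj u w → near w := by
    intro u
    have hu := (G.reachable_iff_reflTransGen r u).1 (hG.preconnected r u)
    induction hu with
    | refl =>
      exact Or.inl ⟨r, h.root_mem, not_disjoint_iff.2 ⟨r, by simp, h.center_mem r h.root_mem⟩⟩
    | @tail y z _ hyz ih =>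
      rcases ih with hy | hy
      · by_contra! hc
        obtain ⟨hz, w, hzw, hw⟩ := hc
        simp only [near, not_exists, not_and, not_not] at hz hw
        obtain ⟨p, hp, hyp⟩ := hnear y hy
        obtain ⟨hzs, hext⟩ := h.extend hG hq hp hzw (hstep z y hyz.symm p hp hyp) hz hw
        have := hmax _ ⟨_, _, hext⟩
        rw [card_insert_of_notMem hzs] at this
        omega
      · exact Or.inl (hy z hyz)
  intro u
  rcases hcov u with hu | hu
  · obtain ⟨a, ha, hua⟩ := hnear u hu
    exact ⟨a, ha, hua.trans (by norm_num)⟩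
  · obtain ⟨w, huw⟩ := hdeg u
    obtain ⟨a, ha, hwa⟩ := hnear w (hu w huw)
    exact ⟨a, ha, hstep u w huw a ha hwa⟩

lemma IsTreePacking.card_le {q : ℕ} {r : V} {s : Finset V} {d : V → V → ℕ} {B : V → Finset V}
    (h : IsTreePacking G q r s d B) :
    #(G.distBall 3 r) + (#s - 1) * q ≤ Fintype.card V := by
  calc #(G.distBall 3 r) + (#s - 1) * q ≤ #(B r) + ∑ a ∈ s.erase r, #(B a) := by
        rw [h.root_eq, ← card_erase_of_mem h.root_mem, ← smul_eq_mul]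
        gcongr
        exact card_nsmul_le_sum _ _ _ fun a ha => h.le_card a (mem_of_mem_erase ha)
    _ = #(s.biUnion B) := by
        rw [add_sum_erase s (fun a => #(B a)) h.root_mem, card_biUnion h.disjoint]
    _ ≤ _ := card_le_univ _

/-- The eccentricity sum of a graph covered by a tree packing, in terms of the diameter `D` of the
tree. -/
lemma IsTreePacking.exists_sum_eccent_le (hG : G.Connected) {q : ℕ} {r : V} {s : Finset V}
    {d : V → V → ℕ} {B : V → Finset V} (h : IsTreePacking G q r s d B)
    (hcov : ∀ u, ∃ a ∈ s, G.dist u a ≤ 6) :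
    ∃ D, D + 1 ≤ #s ∧ 2 * ∑ u, _root_.eccent G u + 3 * q * D ^ 2 ≤
      12 * Fintype.card V * D + 24 * Fintype.card V + 3 * q := by
  have hf : ∀ u, ∃ a ∈ s, G.dist u a ≤ 6 ∧ ∀ b ∈ s, u ∈ B b → a = b := by
    intro u
    by_cases hu : ∃ b ∈ s, u ∈ B b
    · obtain ⟨b, hb, hub⟩ := hu
      have h1 := mem_distBall.1 (h.subset_distBall b hb hub)
      rw [dist_comm] at h1
      refine ⟨b, hb, h1.trans (by norm_num), fun c hc huc => ?_⟩
      by_contra hbc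
      exact Finset.disjoint_left.1 (h.disjoint b hb c hc hbc) hub huc
    · push Not at hu
      obtain ⟨a, ha, hua⟩ := hcov u
      exact ⟨a, ha, hua, fun b hb hub => absurd hub (hu b hb)⟩
  choose f hfs hfd hfB using hf
  obtain ⟨⟨a, b⟩, hab, hmax⟩ := Finset.exists_max_image (s ×ˢ s) (fun p => d p.1 p.2)
    ⟨(r, r), mk_mem_product h.root_mem h.root_mem⟩
  obtain ⟨ha, hb⟩ := mem_product.1 hab
  replace hmax : ∀ x ∈ s, ∀ y ∈ s, d x y ≤ d a b := fun x hx y hy =>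
    hmax (x, y) (mk_mem_product hx hy)
  have hpath : ∀ i, ∃ z, i ≤ d a b → z ∈ s ∧ d a z = i ∧ d z b = d a b - i := by
    intro i
    by_cases hi : i ≤ d a b
    · obtain ⟨z, hz⟩ := h.isTreeMetric.exists_between a ha b hb i hi
      exact ⟨z, fun _ => hz⟩
    · exact ⟨a, fun hi' => absurd hi' hi⟩
  choose z hz using hpath
  set D := d a b with hD
  replace hz : ∀ i ∈ range (D + 1), z i ∈ s ∧ d a (z i) = i ∧ d (z i) b = D - i := fun i hi =>
    hz i (Nat.lt_succ_iff.1 (mem_range.1 hi))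
  have hzinj : Set.InjOn z (range (D + 1)) := by
    intro i hi j hj hij
    rw [← (hz i hi).2.1, ← (hz j hj).2.1, hij]
  have hDs : D + 1 ≤ #s := by
    rw [← card_range (D + 1)]
    exact card_le_card_of_injOn z (fun i hi => (hz i hi).1) hzinj
  set E : V → ℕ := fun x => max (d x a) (d x b) with hE
  have hED : ∀ x ∈ s, E x ≤ D := fun x hx => max_le (hmax x hx a ha) (hmax x hx b hb)
  have hecc : ∀ u, _root_.eccent G u ≤ 6 * E (f u) + 12 := by
    intro u
    refine csSup_le (Set.range_nonempty_iff_nonempty.2 ⟨u⟩) ?_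
    rintro _ ⟨v, rfl⟩
    have h1 := h.isTreeMetric.four_point (f u) (hfs u) (f v) (hfs v) a ha b hb
    have h2 := h.dist_le (f u) (hfs u) (f v) (hfs v)
    have h3 := hmax (f v) (hfs v) a ha
    have h4 := hmax (f v) (hfs v) b hb
    have h5 := hG.dist_triangle (u := u) (v := f u) (w := v)
    have h6 := hG.dist_triangle (u := f u) (v := f v) (w := v)
    have h7 := hfd u
    have h8 := hfd v
    rw [dist_comm] at h8
    simp only [hE]
    omega
  have hsum : ∑ u, E (f u) + q * ∑ i ∈ range (D + 1), min i (D - i) ≤ Fintype.card V * D := by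
    have h1 : q * ∑ i ∈ range (D + 1), min i (D - i) ≤ ∑ u, (D - E (f u)) := by
      calc q * ∑ i ∈ range (D + 1), min i (D - i)
          ≤ ∑ i ∈ range (D + 1), ∑ u ∈ B (z i), (D - E (f u)) := by
            rw [mul_sum]
            refine sum_le_sum fun i hi => ?_
            obtain ⟨hzs, hz1, hz2⟩ := hz i hi
            have hsym := h.isTreeMetric.symm a (z i)
            refine (Nat.mul_le_mul_right _ (h.le_card _ hzs)).trans ?_
            rw [← smul_eq_mul]
            refine card_nsmul_le_sum _ _ _ fun u hu => ?_
            rw [hfB u _ hzs hu]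
            have := mem_range.1 hi
            simp only [hE]
            omega
        _ = ∑ u ∈ (range (D + 1)).biUnion (fun i => B (z i)), (D - E (f u)) := by
            rw [sum_biUnion]
            intro i hi j hj hij
            exact h.disjoint _ (hz i hi).1 _ (hz j hj).1 fun e => hij (hzinj hi hj e)
        _ ≤ _ := sum_le_sum_of_subset (subset_univ _)
    calc _ ≤ ∑ u, E (f u) + ∑ u, (D - E (f u)) := by gcongr
      _ = ∑ u : V, D := by
        rw [← sum_add_distrib]
        refine sum_congr rfl fun u _ => ?_
        have := hED (f u) (hfs u)
        omega
      _ = _ := by simp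
  have htotal : ∑ u, _root_.eccent G u ≤ 6 * ∑ u, E (f u) + 12 * Fintype.card V := by
    calc ∑ u, _root_.eccent G u ≤ ∑ u, (6 * E (f u) + 12) := sum_le_sum fun u _ => hecc u
      _ = _ := by
        rw [sum_add_distrib, mul_sum]
        simp [mul_comm]
  have hmin := Nat.mul_le_mul_left (3 * q) (sq_le_four_mul_sum_min D)
  refine ⟨D, hDs, ?_⟩
  nlinarith

end SimpleGraph

theorem stmt_13 {V : Type*} [Fintype V] (G : SimpleGraph V) [DecidableRel G.Adj]
    (hG : G.Connected) (h4 : CycleFree G 4) (h5 : CycleFree G 5) (n δ Δ : ℕ)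
    (hn : n = Fintype.card V) (hδ : δ = G.minDegree) (h3 : 3 ≤ δ)
    (hΔ : Δ = G.maxDegree)
    (δc Δc : ℝ)
    (hδc : δc = if Even δ then 2 * (δ : ℝ) ^ 2 - 5 * δ + 5 else 2 * (δ : ℝ) ^ 2 - 5 * δ + 7)
    (hΔc : Δc = (Δ : ℝ) * ((δ : ℝ) - 1) + ((δ : ℝ) - 2) * Real.sqrt ((Δ : ℝ) * ((δ : ℝ) - 3))
      + 3 / 2) :
    avec G ≤ ((n : ℝ) - Δc) / (2 * δc) * ((9 * n + 3 * Δc) / n) + 21 := by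
  obtain ⟨k, rfl⟩ : ∃ k, δ = k + 2 := ⟨δ - 2, by omega⟩
  have hk1 : 1 ≤ k := by omega
  have hk : ∀ v, k + 2 ≤ G.degree v := fun v => hδ ▸ G.minDegree_le_degree v
  have := hG.nonempty
  obtain ⟨r, hr⟩ := G.exists_maximal_degree_vertex
  set q := 2 * k ^ 2 + 3 * k + 3 + (if Even k then 0 else 2) with hq
  have hqc : (q : ℝ) = δc := by
    rw [hδc, hq]
    simp only [Nat.even_add, even_two, iff_true]
    split_ifs <;> push_cast <;> ring
  have hball : Δc ≤ (G.distBall 3 r).card := by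
    have := card_distBall_three hG h4 h5 hk1 (fun v => by convert hk v) r
    refine le_trans (le_of_eq ?_) this
    rw [hΔc, hΔ, hr, show ((k + 2 : ℕ) : ℝ) - 1 = k + 1 by push_cast; ring,
      show ((k + 2 : ℕ) : ℝ) - 2 = k by push_cast; ring,
      show ((k + 2 : ℕ) : ℝ) - 3 = k - 1 by push_cast; ring]
    congr!
  obtain ⟨s, d, B, hpack, hcov⟩ := exists_isTreePacking_covering hG (q := q) r
    (fun v => by
      have := hk v
      exact (G.degree_pos_iff_exists_adj v).1 (by omega))
    (fun u v huv => card_distBall_union_distBall hG h4 h5 hk1 (fun v => by convert hk v) huv)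
  have hcard := hpack.card_le
  obtain ⟨D, hDs, hsum⟩ := hpack.exists_sum_eccent_le hG hcov
  rw [← hn] at hcard hsum
  have hcard' : Δc + D * δc ≤ n := by
    have h1 : (G.distBall 3 r).card + D * q ≤ n :=
      le_trans (by gcongr; omega) hcard
    rw [← hqc]
    have h2 : ((G.distBall 3 r).card : ℝ) + D * q ≤ n := by exact_mod_cast h1
    linarith
  have hsum' : 2 * (∑ u, (_root_.eccent G u : ℝ)) + 3 * δc * D ^ 2 ≤ 12 * n * D + 24 * n + 3 * δc := by
    rw [← hqc]
    exact_mod_cast hsum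
  have hδpos : 0 < δc := by
    rw [← hqc, hq]
    positivity
  have hδn : δc ≤ n := by
    rw [← hqc]
    have h1 := hpack.le_card r hpack.root_mem
    have h2 := Finset.card_le_univ (B r)
    rw [← hn] at h2
    exact_mod_cast h1.trans h2
  have hΔpos : 0 ≤ Δc := by
    have : (0 : ℝ) ≤ (k + 2 : ℕ) - 1 := by push_cast; linarith [(k.cast_nonneg : (0 : ℝ) ≤ k)]
    have : (0 : ℝ) ≤ (k + 2 : ℕ) - 2 := by push_cast; linarith [(k.cast_nonneg : (0 : ℝ) ≤ k)]
    rw [hΔc]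
    positivity
  have hnpos : (0 : ℝ) < n := hδpos.trans_le hδn
  have havec : avec G = (∑ u, (_root_.eccent G u : ℝ)) / n := by
    rw [avec, finsum_eq_sum_of_fintype, Nat.card_eq_fintype_card, hn]
  obtain ⟨X, hX⟩ : ∃ X, (n : ℝ) = Δc + δc * X := ⟨(n - Δc) / δc, by field_simp; ring⟩
  have hDX : (D : ℝ) ≤ X := le_of_mul_le_mul_left (by linarith) hδpos
  have hquot : ((n : ℝ) - Δc) / (2 * δc) = X / 2 := by
    rw [hX]
    field_simp
    ring
  rw [havec, hquot, div_le_iff₀ hnpos, add_mul, mul_assoc, div_mul_cancel₀ _ hnpos.ne']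
  have hmono : 12 * n * D - 3 * δc * D ^ 2 ≤ 12 * n * X - 3 * δc * X ^ 2 := by
    have h1 : 0 ≤ (X - D) * Δc := mul_nonneg (by linarith) hΔpos
    have h2 : 0 ≤ (X - D) * (δc * (3 * X - D)) :=
      mul_nonneg (by linarith) (mul_nonneg hδpos.le (by
        linarith [(D.cast_nonneg : (0 : ℝ) ≤ D)]))
    rw [hX]
    nlinarith
  have hexact : 12 * n * X - 3 * δc * X ^ 2 = 2 * (X / 2 * (9 * n + 3 * Δc)) := by
    rw [hX]
    ring
  linarith
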